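/- arXiv:2106.14453 — 2 statements merged into one kernel-verified Lean document; each statement's English description precedes it below -/
import Mathlib

section
/- Let k be an algebraically closed field of characteristic ≠ 2, and let A_1, A_2 be symmetric (n+1)×(n+1) matrices over k defining an incompressible pencil (no nonzero common kernel vector) with splitting type (u,v), i.e., the image of the map of graded k[z_1,z_2]-modules given by z_1A_1+z_2A_2 decomposes with u generators in degree 1 and v generators in degree 0 (equivalently, the image sheaf on P^1 is O(−1)^u ⊕ O^v). Then u ≥ v. -/
open MvPolynomial

set_option linter.unusedSectionVars false

namespace Pencil12

variable {k : Type*} [Field k]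

lemma coeff_zero_of_mul_eq {t : ℕ} {p q : MvPolynomial (Fin 2) k}
    (h : X 0 ^ t * q = X 1 ^ t * p) (m : Fin 2 →₀ ℕ) (hm : m 0 < t) : coeff m p = 0 := by
  have h1 := congrArg (coeff (Finsupp.single 1 t + m)) h
  rw [X_pow_eq_monomial, X_pow_eq_monomial, coeff_monomial_mul, coeff_monomial_mul'] at h1
  rw [if_neg] at h1
  · simpa using h1.symm
  · intro hle
    have := hle 0
    simp at this
    omega

lemma eq_zero_of_mul_eq {t d : ℕ} (hd : d < t) {p q : MvPolynomial (Fin 2) k}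
    (hp : p.IsHomogeneous d) (h : X 0 ^ t * q = X 1 ^ t * p) : p = 0 := by
  ext m
  rw [coeff_zero]
  by_cases hm : m 0 < t
  · exact coeff_zero_of_mul_eq h m hm
  · apply hp.coeff_eq_zero
    rw [Finsupp.degree_eq_sum, Fin.sum_univ_two]
    omega

lemma eq_C_mul_of_mul_eq {t : ℕ} {p q : MvPolynomial (Fin 2) k}
    (hp : p.IsHomogeneous t) (h : X 0 ^ t * q = X 1 ^ t * p) :
    p = X 0 ^ t * C (coeff (Finsupp.single 0 t) p) := by
  ext m
  rw [mul_comm, C_mul_X_pow_eq_monomial, coeff_monomial]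
  by_cases hm : m 0 < t
  · rw [coeff_zero_of_mul_eq h m hm, if_neg]
    rintro rfl
    simp at hm
  · split_ifs with h1
    · rw [h1]
    · apply hp.coeff_eq_zero
      rw [Finsupp.degree_eq_sum, Fin.sum_univ_two]
      intro h2
      apply h1
      ext i
      fin_cases i <;> simp <;> omega

/-- Binary forms of degree `m` with given coefficients. -/
noncomputable def form (k : Type*) [Field k] (m : ℕ) :
    (Fin (m + 1) → k) →ₗ[k] MvPolynomial (Fin 2) k :=
  ∑ i : Fin (m + 1), (monomial (Finsupp.single 0 (i : ℕ) + Finsupp.single 1 (m - i))).comp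
    (LinearMap.proj i)

lemma form_hom (m : ℕ) (c : Fin (m + 1) → k) : (form k m c).IsHomogeneous m := by
  simp only [form, LinearMap.sum_apply, LinearMap.comp_apply]
  apply IsHomogeneous.sum
  intro i _
  apply isHomogeneous_monomial
  rw [Finsupp.degree_eq_sum, Fin.sum_univ_two]
  simp
  omega

lemma form_inj (m : ℕ) (c : Fin (m + 1) → k) (h : form k m c = 0) : c = 0 := by
  ext j
  have h1 := congrArg (coeff (Finsupp.single 0 (j : ℕ) + Finsupp.single 1 (m - j))) h
  simp only [form, LinearMap.sum_apply, LinearMap.comp_apply, coeff_sum, coeff_monomial] at h1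
  rw [Finset.sum_eq_single j] at h1
  · simpa using h1
  · intro b _ hb
    rw [if_neg]
    intro h2
    have := DFunLike.congr_fun h2 0
    simp at this
    exact hb (Fin.ext this)
  · simp

variable {ι : Type*} [Fintype ι]

/-- graded pieces of the image -/
noncomputable abbrev img (M : Matrix ι ι (MvPolynomial (Fin 2) k)) (t : ℕ) :
    Submodule k (ι → MvPolynomial (Fin 2) k) :=
  Submodule.restrictScalars k (LinearMap.range M.mulVecLin) ⊓
    Submodule.pi Set.univ (fun _ : ι => homogeneousSubmodule (Fin 2) k t)

lemma mem_img {M : Matrix ι ι (MvPolynomial (Fin 2) k)} {t : ℕ}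
    {y : ι → MvPolynomial (Fin 2) k} :
    y ∈ img M t ↔ (∃ x, M.mulVec x = y) ∧ ∀ i, (y i).IsHomogeneous t := by
  simp [img, Submodule.mem_pi, mem_homogeneousSubmodule]

lemma homComp_mul {a b : MvPolynomial (Fin 2) k} (ha : a.IsHomogeneous 1) (t : ℕ) :
    homogeneousComponent (1 + t) (a * b) = a * homogeneousComponent t b := by
  let _ := gradedAlgebra (σ := Fin 2) (R := k)
  have := DirectSum.coe_decompose_mul_add_of_left_mem (homogeneousSubmodule (Fin 2) k)
    (i := 1) (j := t) (a := a) (b := b) ha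
  rw [← decomposition.decompose'_apply, ← decomposition.decompose'_apply]
  exact this

lemma exists_hom {M : Matrix ι ι (MvPolynomial (Fin 2) k)} (hM : ∀ i j, (M i j).IsHomogeneous 1)
    {t : ℕ} {y : ι → MvPolynomial (Fin 2) k} (hy : y ∈ img M (1 + t)) :
    ∃ x, M.mulVec x = y ∧ ∀ i, (x i).IsHomogeneous t := by
  obtain ⟨⟨x, rfl⟩, h⟩ := mem_img.1 hy
  refine ⟨fun i => homogeneousComponent t (x i), ?_, 
    fun i => homogeneousComponent_isHomogeneous _ _⟩
  ext1 i
  rw [← homogeneousComponent_eq_self (h i)]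
  simp only [Matrix.mulVec, dotProduct, map_sum]
  exact Finset.sum_congr rfl fun j _ => (homComp_mul (hM i j) t).symm

lemma img_mul {M : Matrix ι ι (MvPolynomial (Fin 2) k)} {t s : ℕ}
    {y : ι → MvPolynomial (Fin 2) k} (hy : y ∈ img M t) {a : MvPolynomial (Fin 2) k}
    (ha : a.IsHomogeneous s) : a • y ∈ img M (s + t) := by
  obtain ⟨⟨x, rfl⟩, h⟩ := mem_img.1 hy
  exact mem_img.2 ⟨⟨a • x, by rw [Matrix.mulVec_smul]⟩, fun i => ha.mul (h i)⟩

/-- Multiplication of constant vectors by a polynomial. -/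
noncomputable def cst (ι : Type*) (a : MvPolynomial (Fin 2) k) :
    (ι → k) →ₗ[k] (ι → MvPolynomial (Fin 2) k) :=
  LinearMap.pi fun i => (Algebra.lsmul k k (MvPolynomial (Fin 2) k) a).comp
    ((Algebra.linearMap k (MvPolynomial (Fin 2) k)).comp (LinearMap.proj i))

lemma cst_apply (a : MvPolynomial (Fin 2) k) (w : ι → k) (i : ι) :
    cst ι a w i = a * C (w i) := rfl

lemma cst_inj {a : MvPolynomial (Fin 2) k} (ha : a ≠ 0) : Function.Injective (cst ι a) := by
  intro w w' h
  ext i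
  have := congrFun h i
  rw [cst_apply, cst_apply] at this
  exact C_injective _ _ (mul_left_cancel₀ ha this)

lemma lsmul_inj {a : MvPolynomial (Fin 2) k} (ha : a ≠ 0) :
    Function.Injective (Algebra.lsmul k k (ι → MvPolynomial (Fin 2) k) a) := by
  intro w w' h
  ext1 i
  exact mul_left_cancel₀ ha (congrFun h i)

/-- Many constant global sections. -/
lemma step1 (M : Matrix ι ι (MvPolynomial (Fin 2) k)) (t R v : ℕ)
    (hv : 0 < v)
    (h1 : Module.finrank k (img M t) = R * t + v)
    (h2 : Module.finrank k (img M (t + t)) = R * (t + t) + v) :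
    ∃ W : Submodule k (ι → k), v ≤ Module.finrank k W ∧
      ∀ w ∈ W, cst ι (X 0 ^ t) w ∈ img M t ∧ cst ι (X 1 ^ t) w ∈ img M t := by
  have f1 : Module.Finite k (img M t) := Module.finite_of_finrank_pos (by omega)
  have f2 : Module.Finite k (img M (t + t)) := Module.finite_of_finrank_pos (by omega)
  have hx0 : (X 0 ^ t : MvPolynomial (Fin 2) k) ≠ 0 := pow_ne_zero _ (X_ne_zero (R := k) _)
  have hx1 : (X 1 ^ t : MvPolynomial (Fin 2) k) ≠ 0 := pow_ne_zero _ (X_ne_zero (R := k) _)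
  set L0 := Algebra.lsmul (A := MvPolynomial (Fin 2) k) k k (ι → MvPolynomial (Fin 2) k) (X 0 ^ t) with hL0
  set L1 := Algebra.lsmul (A := MvPolynomial (Fin 2) k) k k (ι → MvPolynomial (Fin 2) k) (X 1 ^ t) with hL1
  set g := cst ι (X 0 ^ t * X 1 ^ t : MvPolynomial (Fin 2) k) with hg
  have hgi : Function.Injective g := cst_inj (mul_ne_zero hx0 hx1)
  set J := (img M t).map L0 ⊓ (img M t).map L1 with hJ
  have e0 : Module.finrank k ((img M t).map L0) = R * t + v := by
    rw [← h1]
    exact (LinearEquiv.finrank_eq (Submodule.equivMapOfInjective L0 (lsmul_inj hx0) _)).symm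
  have e1 : Module.finrank k ((img M t).map L1) = R * t + v := by
    rw [← h1]
    exact (LinearEquiv.finrank_eq (Submodule.equivMapOfInjective L1 (lsmul_inj hx1) _)).symm
  have es : Module.finrank k ↥((img M t).map L0 ⊔ (img M t).map L1) ≤ R * (t + t) + v := by
    rw [← h2]
    apply Submodule.finrank_mono
    apply sup_le
    · rintro _ ⟨y, hy, rfl⟩
      exact img_mul hy (isHomogeneous_X_pow 0 t)
    · rintro _ ⟨y, hy, rfl⟩
      exact img_mul hy (isHomogeneous_X_pow 1 t)
  have ej := Submodule.finrank_sup_add_finrank_inf_eq ((img M t).map L0) ((img M t).map L1)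
  have hJv : v ≤ Module.finrank k J := by
    rw [e0, e1, ← hJ] at ej
    rw [mul_add] at es
    omega
  have hJg : J ≤ LinearMap.range g := by
    rintro y ⟨⟨a, ha, hay⟩, ⟨b, hb, hby⟩⟩
    refine ⟨fun i => coeff (Finsupp.single 0 t) (b i), ?_⟩
    ext1 i
    rw [hg, cst_apply, ← hby]
    change _ = X 1 ^ t * b i
    conv_rhs => rw [eq_C_mul_of_mul_eq (p := b i) (q := a i) ((mem_img.1 hb).2 i) (by
      have := congrFun (hay.trans hby.symm) i
      exact this)]
    ring
  refine ⟨J.comap g, ?_, ?_⟩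
  · rw [LinearEquiv.finrank_eq (Submodule.equivMapOfInjective g hgi _),
      Submodule.map_comap_eq_of_le hJg]
    exact hJv
  · rintro w ⟨⟨a, ha, hay⟩, ⟨b, hb, hby⟩⟩
    constructor
    · suffices hs : cst ι (X 0 ^ t) w = b by rw [hs]; exact hb
      apply lsmul_inj hx1
      rw [← hL1, hby]
      ext1 i
      rw [hg, cst_apply, hL1, Algebra.lsmul_coe]
      beta_reduce
      rw [Pi.smul_apply, cst_apply, smul_eq_mul]
      ring
    · suffices hs : cst ι (X 1 ^ t) w = a by rw [hs]; exact ha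
      apply lsmul_inj hx0
      rw [← hL0, hay]
      ext1 i
      rw [hg, cst_apply, hL0, Algebra.lsmul_coe]
      beta_reduce
      rw [Pi.smul_apply, cst_apply, smul_eq_mul]
      ring

lemma dot_symm {M : Matrix ι ι (MvPolynomial (Fin 2) k)} (hS : M.IsSymm)
    (x y : ι → MvPolynomial (Fin 2) k) :
    M.mulVec x ⬝ᵥ y = x ⬝ᵥ M.mulVec y := by
  rw [Matrix.dotProduct_mulVec, ← Matrix.mulVec_transpose, hS.eq]

lemma cst_eq (a : MvPolynomial (Fin 2) k) (w : ι → k) : cst ι a w = a • cst ι 1 w := by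
  ext1 i
  simp [cst_apply]

/-- Isotropy. -/
lemma step2 {M : Matrix ι ι (MvPolynomial (Fin 2) k)} (hS : M.IsSymm)
    {t : ℕ} {w w' : ι → k} {x x' y : ι → MvPolynomial (Fin 2) k}
    (hx : M.mulVec x = cst ι (X 0 ^ (1 + t)) w) (hxh : ∀ i, (x i).IsHomogeneous t)
    (hx' : M.mulVec x' = cst ι (X 1 ^ (1 + t)) w)
    (hy : M.mulVec y = cst ι (X 0 ^ (1 + t)) w') : x ⬝ᵥ cst ι 1 w' = 0 := by
  have hx0 : (X 0 ^ (1 + t) : MvPolynomial (Fin 2) k) ≠ 0 := pow_ne_zero _ (X_ne_zero (R := k) _)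
  apply eq_zero_of_mul_eq (t := 1 + t) (d := t) (q := x' ⬝ᵥ cst ι 1 w') (by omega)
  · apply IsHomogeneous.sum
    intro i _
    rw [cst_apply, one_mul]
    exact (hxh i).mul (isHomogeneous_C _ _)
  · apply mul_left_cancel₀ hx0
    have a1 := dot_symm hS x y
    have a2 := dot_symm hS x' y
    rw [hx, hy, cst_eq, cst_eq _ w', smul_dotProduct, dotProduct_smul] at a1
    rw [hx', hy, cst_eq, cst_eq _ w', smul_dotProduct, dotProduct_smul] at a2
    simp only [smul_eq_mul] at a1 a2
    rw [← a2, mul_left_comm, a1, mul_left_comm]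

/-- Dual vectors to a basis of a subspace. -/
lemma exists_dual_basis [DecidableEq ι] (W : Submodule k (ι → k)) :
    ∃ d, Module.finrank k W = d ∧ ∃ w e : Fin d → ι → k, (∀ i, w i ∈ W) ∧
      ∀ i j, w i ⬝ᵥ e j = if i = j then 1 else 0 := by
  let b := Module.finBasis k W
  obtain ⟨p, hp⟩ := W.subtype.exists_leftInverse_of_injective W.ker_subtype
  refine ⟨_, rfl, fun i => b i, fun j l => b.coord j (p (Pi.single l 1)), fun i => (b i).2, fun i j => ?_⟩
  have h1 : p (b i : ι → k) = b i := LinearMap.congr_fun hp (b i)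
  have h2 : b.coord j (p (b i : ι → k)) = if i = j then 1 else 0 := by
    rw [h1, Module.Basis.coord_apply, Module.Basis.repr_self, Finsupp.single_apply]
  rw [← h2]
  conv_rhs => rw [pi_eq_sum_univ' (b i : ι → k)]
  simp only [map_sum, map_smul, dotProduct, smul_eq_mul]

lemma cst_dot (w e : ι → k) : cst ι (1 : MvPolynomial (Fin 2) k) w ⬝ᵥ cst ι 1 e = C (w ⬝ᵥ e) := by
  simp [dotProduct, cst_apply, map_sum]

lemma step3 [DecidableEq ι] {M : Matrix ι ι (MvPolynomial (Fin 2) k)} (hS : M.IsSymm)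
    (hM : ∀ i j, (M i j).IsHomogeneous 1) (t m : ℕ) (W : Submodule k (ι → k))
    (hW : ∀ w ∈ W, cst ι (X 0 ^ (1 + t)) w ∈ img M (1 + t) ∧
      cst ι (X 1 ^ (1 + t)) w ∈ img M (1 + t))
    (hf : Module.Finite k (img M (1 + t + m))) :
    Module.finrank k W * (t + m + 1) + Module.finrank k W * (m + 1) ≤
      Module.finrank k (img M (1 + t + m)) := by
  obtain ⟨d, hd, w, e, hw, hwe⟩ := exists_dual_basis W
  rw [hd]
  have hx0 : (X 0 ^ (1 + t) : MvPolynomial (Fin 2) k) ≠ 0 := pow_ne_zero _ (X_ne_zero (R := k) _)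
  choose x hx hxh using fun i => exists_hom hM (hW (w i) (hw i)).1
  choose x' hx' _ using fun i => exists_hom hM (hW (w i) (hw i)).2
  have iso : ∀ i j, x i ⬝ᵥ cst ι 1 (w j) = 0 := fun i j =>
    step2 hS (hx i) (hxh i) (hx' i) (hx j)
  let Ψ : ((Fin d → Fin (t + m + 1) → k) × (Fin d → Fin (m + 1) → k)) →ₗ[k]
      (ι → MvPolynomial (Fin 2) k) :=
    { toFun := fun c => ∑ i, form k (t + m) (c.1 i) • M.mulVec (cst ι 1 (e i)) +
        ∑ i, form k m (c.2 i) • M.mulVec (x i)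
      map_add' := by
        intro a b
        simp only [Prod.fst_add, Prod.snd_add, Pi.add_apply, map_add, add_smul,
          Finset.sum_add_distrib]
        abel
      map_smul' := by
        intro r a
        simp only [Prod.smul_fst, Prod.smul_snd, Pi.smul_apply, map_smul, smul_assoc,
          ← Finset.smul_sum, smul_add, RingHom.id_apply] }
  have hΨ : ∀ c, Ψ c = ∑ i, form k (t + m) (c.1 i) • M.mulVec (cst ι 1 (e i)) +
        ∑ i, form k m (c.2 i) • M.mulVec (x i) := fun c => rfl
  have hmem : ∀ c, Ψ c ∈ img M (1 + t + m) := by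
    intro c
    rw [hΨ]
    apply Submodule.add_mem
    · apply Submodule.sum_mem
      intro i _
      rw [show 1 + t + m = (t + m) + 1 by ring]
      apply img_mul _ (form_hom _ _)
      refine mem_img.2 ⟨⟨_, rfl⟩, fun j => ?_⟩
      apply IsHomogeneous.sum
      intro l _
      rw [cst_apply, one_mul]
      exact (hM j l).mul (isHomogeneous_C _ _)
    · apply Submodule.sum_mem
      intro i _
      rw [show 1 + t + m = m + (1 + t) by ring, hx i]
      exact img_mul (hW (w i) (hw i)).1 (form_hom _ _)
  have hinj : Function.Injective (Ψ.codRestrict (img M (1 + t + m)) hmem) := by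
    rw [← LinearMap.ker_eq_bot, LinearMap.ker_codRestrict, LinearMap.ker_eq_bot']
    rintro ⟨a, b⟩ h0
    rw [hΨ] at h0
    dsimp only at h0
    -- pairing with `x j`
    have ha : a = 0 := by
      ext1 j
      apply form_inj
      have h1 := congrArg (fun y => x j ⬝ᵥ y) h0
      simp only [dotProduct_add, dotProduct_sum, dotProduct_smul, dotProduct_zero] at h1
      simp only [← dot_symm hS, hx j] at h1
      simp only [cst_eq (X 0 ^ (1 + t)), smul_dotProduct, cst_dot, hwe,
        dotProduct_comm _ (x _), dotProduct_smul, iso, smul_zero, Finset.sum_const_zero, add_zero] at h1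
      simp only [smul_eq_mul, apply_ite C, map_one, map_zero, mul_ite, mul_one, mul_zero,
        Finset.sum_ite_eq, Finset.mem_univ, if_true] at h1
      exact (mul_eq_zero.1 h1).resolve_right hx0
    subst ha
    have hb : b = 0 := by
      ext1 j
      apply form_inj
      simp only [Pi.zero_apply, map_zero, zero_smul, Finset.sum_const_zero, zero_add] at h0
      have h1 := congrArg (fun y => y ⬝ᵥ cst ι 1 (e j)) h0
      simp only [sum_dotProduct, zero_dotProduct, smul_dotProduct, hx,
        cst_eq (X 0 ^ (1 + t)), cst_dot, hwe] at h1
      simp only [smul_eq_mul, apply_ite C, map_one, map_zero, mul_ite, mul_one, mul_zero,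
        Finset.sum_ite_eq', Finset.mem_univ, if_true] at h1
      exact (mul_eq_zero.1 h1).resolve_right hx0
    subst hb
    rfl
  have := LinearMap.finrank_le_finrank_of_injective hinj
  simpa [Module.finrank_prod, Module.finrank_pi_fintype] using this

end Pencil12


/-- An incompressible pencil of symmetric matrices with splitting type `(u,v)`
(expressed via the Hilbert function of the graded image of the matrix pencil
`z₁A₁ + z₂A₂`, which equals `u·t + v·(t+1)` in all large degrees `t`, as for
`O(−1)^u ⊕ O^v` on `P¹`) satisfies `u ≥ v`. -/
theorem stmt_12 {k : Type*} [Field k] [IsAlgClosed k] (h2 : (2 : k) ≠ 0) (n : ℕ)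
    (A₁ A₂ : Matrix (Fin (n + 1)) (Fin (n + 1)) k)
    (hA₁ : A₁.IsSymm) (hA₂ : A₂.IsSymm)
    (hinc : ∀ x : Fin (n + 1) → k, A₁.mulVec x = 0 → A₂.mulVec x = 0 → x = 0)
    (u v : ℕ)
    (hsplit : ∃ t₀ : ℕ, ∀ t ≥ t₀,
      Module.finrank k
        ↥(Submodule.restrictScalars k
            (LinearMap.range
              ((Matrix.of (fun i j : Fin (n + 1) =>
                (C (A₁ i j) * X 0 + C (A₂ i j) * X 1 :
                  MvPolynomial (Fin 2) k))).mulVecLin)) ⊓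
          Submodule.pi Set.univ
            (fun _ : Fin (n + 1) => homogeneousSubmodule (Fin 2) k t)) =
        u * t + v * (t + 1)) :
    v ≤ u := by
  rcases Nat.eq_zero_or_pos v with hv | hv
  · omega
  obtain ⟨t, ht⟩ := hsplit
  set M : Matrix (Fin (n + 1)) (Fin (n + 1)) (MvPolynomial (Fin 2) k) :=
    Matrix.of (fun i j : Fin (n + 1) =>
      (C (A₁ i j) * X 0 + C (A₂ i j) * X 1 : MvPolynomial (Fin 2) k)) with hMdef
  have hH : ∀ s, t ≤ s → Module.finrank k (Pencil12.img M s) = (u + v) * s + v := by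
    intro s hs
    rw [ht s hs]
    ring
  have hS : M.IsSymm := by
    ext i j
    simp [hMdef, Matrix.transpose_apply, hA₁.apply i j, hA₂.apply i j]
  have hM : ∀ i j, (M i j).IsHomogeneous 1 := by
    intro i j
    apply IsHomogeneous.add
    · exact (isHomogeneous_C_mul_X _ _)
    · exact (isHomogeneous_C_mul_X _ _)
  obtain ⟨W, hWv, hW⟩ := Pencil12.step1 M (1 + t) (u + v) v hv (hH _ (by omega)) (hH _ (by omega))
  by_contra hlt
  push Not at hlt
  have hfin := hH (1 + t + (u * (1 + t) + 1)) (by omega)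
  have key := Pencil12.step3 hS hM t (u * (1 + t) + 1) W hW
    (Module.finite_of_finrank_pos (by rw [hfin]; omega))
  rw [hfin] at key
  generalize Module.finrank k W = d at *
  obtain ⟨r, rfl⟩ := Nat.exists_eq_add_of_lt hlt
  obtain ⟨q, rfl⟩ := Nat.exists_eq_add_of_le hWv
  nlinarith [Nat.zero_le (q * (t + (u * (1 + t) + 1) + 1)), Nat.zero_le (q * (u * (1 + t) + 1 + 1)),
    Nat.zero_le (r * (u * (1 + t) + 1))]
end

section
/- Let k be an algebraically closed field of characteristic ≠ 2 and let σ be an incompressible pencil of quadrics in P^n with generic corank r_1 (the minimum over λ ∈ P^1 of the corank of the symmetric matrix z_1A_1+z_2A_2). Then 3·r_1 ≤ n+1. -/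
open Matrix Module in
/-- A polynomial identity argument: if `w` kills `(1 + tM)⁻¹ x` for all good `t ≠ 0`,
then `w` kills `x`. -/
theorem aux_limit {k : Type*} [Field k] [Infinite k] {N : ℕ}
    (M : Matrix (Fin N) (Fin N) k) (w x : Fin N → k)
    (h : ∀ t : k, t ≠ 0 → ∀ v, (∀ u, (1 + t • M) *ᵥ u = 0 → u = 0) →
      (1 + t • M) *ᵥ v = x → w ⬝ᵥ v = 0) : w ⬝ᵥ x = 0 := by
  classical
  let P : Matrix (Fin N) (Fin N) (Polynomial k) :=
    1 + (Polynomial.X : Polynomial k) • M.map Polynomial.C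
  let q : Polynomial k :=
    (fun i => Polynomial.C (w i)) ⬝ᵥ (P.adjugate *ᵥ (fun i => Polynomial.C (x i)))
  have hP : ∀ t : k, (Polynomial.evalRingHom t).mapMatrix P = 1 + t • M := by
    intro t
    ext i j
    simp [P, Matrix.one_apply, apply_ite (Polynomial.eval t)]
    exact mul_comm _ _
  have hdet : ∀ t : k, P.det.eval t = (1 + t • M).det := by
    intro t
    rw [← hP t, ← RingHom.map_det]; rfl
  have hq : ∀ t : k, q.eval t = w ⬝ᵥ ((1 + t • M).adjugate *ᵥ x) := by
    intro t
    rw [← hP t, ← RingHom.map_adjugate]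
    simp [q, dotProduct, mulVec, Polynomial.eval_finsetSum]
  have hz : Polynomial.X * P.det * q = 0 := by
    apply Polynomial.funext
    intro t
    simp only [Polynomial.eval_mul, Polynomial.eval_X, Polynomial.eval_zero]
    by_cases ht : t = 0
    · simp [ht]
    by_cases hd : P.det.eval t = 0
    · simp [hd]
    rw [hdet] at hd
    have hq0 : q.eval t = 0 := by
      rw [hq]
      have := h t ht (((1 + t • M).det)⁻¹ • ((1 + t • M).adjugate *ᵥ x))
        (fun u hu => Matrix.eq_zero_of_mulVec_eq_zero hd hu) (by
          rw [mulVec_smul, mulVec_mulVec, mul_adjugate, smul_mulVec, one_mulVec, smul_smul,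
            inv_mul_cancel₀ hd, one_smul])
      rw [dotProduct_smul, smul_eq_mul] at this
      exact (mul_eq_zero.mp this).resolve_left (inv_ne_zero hd)
    simp [hq0]
  have hd0 : P.det ≠ 0 := by
    intro h0
    have := hdet 0
    simp [h0] at this
  have hq0 : q = 0 :=
    (mul_eq_zero.mp hz).resolve_left (mul_ne_zero Polynomial.X_ne_zero hd0)
  have := hq 0
  simpa [hq0] using this.symm

open Matrix Module in
/-- A generalized inverse. -/
theorem aux_ginv {k : Type*} [Field k] {N : ℕ} (A : Matrix (Fin N) (Fin N) k) :
    ∃ S : Matrix (Fin N) (Fin N) k, ∀ v, A *ᵥ (S *ᵥ (A *ᵥ v)) = A *ᵥ v := by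
  obtain ⟨g, hg⟩ := A.mulVecLin.rangeRestrict.exists_rightInverse_of_surjective
    (LinearMap.range_rangeRestrict _)
  obtain ⟨g', hg'⟩ := LinearMap.exists_extend g
  refine ⟨LinearMap.toMatrix' g', fun v => ?_⟩
  rw [LinearMap.toMatrix'_mulVec]
  have h1 : g' (A *ᵥ v) = g (A.mulVecLin.rangeRestrict v) := by
    rw [← hg']; rfl
  have h2 := congrArg Subtype.val (LinearMap.congr_fun hg (A.mulVecLin.rangeRestrict v))
  rw [h1]
  simpa using h2

open Matrix Module in
theorem aux_core {k : Type*} [Field k] [Infinite k] {N : ℕ}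
    (A B : Matrix (Fin N) (Fin N) k) (hA : A.IsSymm) (hB : B.IsSymm)
    (hinc : ∀ x, A *ᵥ x = 0 → B *ᵥ x = 0 → x = 0) (r : ℕ) (hr : r ≤ N)
    (hrA : A.rank = N - r) (hub : ∀ t : k, (A + t • B).rank ≤ N - r) : 3 * r ≤ N := by
  classical
  have hdim : ∀ C : Matrix (Fin N) (Fin N) k,
      C.rank + finrank k (LinearMap.ker C.mulVecLin) = N := by
    intro C
    have := C.mulVecLin.finrank_range_add_finrank_ker
    simpa [Matrix.rank] using this
  obtain ⟨S, hS⟩ := aux_ginv A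
  set K := LinearMap.ker A.mulVecLin with hK
  have memK : ∀ x, x ∈ K ↔ A *ᵥ x = 0 := fun x => by simp [hK]
  have hKr : finrank k K = r := by have := hdim A; rw [← hK] at this; omega
  have symA : ∀ x y, x ⬝ᵥ (A *ᵥ y) = (A *ᵥ x) ⬝ᵥ y := fun x y => by
    rw [dotProduct_mulVec, ← mulVec_transpose, hA.eq]
  have symB : ∀ x y, x ⬝ᵥ (B *ᵥ y) = (B *ᵥ x) ⬝ᵥ y := fun x y => by
    rw [dotProduct_mulVec, ← mulVec_transpose, hB.eq]
  -- kernel vectors lift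
  have lift : ∀ t : k, t ≠ 0 → ∀ v, (∀ u, (1 + t • (S * B)) *ᵥ u = 0 → u = 0) →
      (1 + t • (S * B)) *ᵥ v ∈ K → (A + t • B) *ᵥ v = 0 := by
    intro t ht v hinj hv
    let T := (1 + t • (S * B)).mulVecLin
    have hTi : Function.Injective T := by
      rw [← LinearMap.ker_eq_bot, LinearMap.ker_eq_bot']
      intro u hu
      exact hinj u hu
    let Kt := LinearMap.ker (A + t • B).mulVecLin
    have hle : Kt.map T ≤ K := by
      rintro _ ⟨u, hu, rfl⟩
      have hu' : (A + t • B) *ᵥ u = 0 := hu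
      rw [add_mulVec, smul_mulVec] at hu'
      have e : t • (B *ᵥ u) = - (A *ᵥ u) := by
        rw [eq_neg_iff_add_eq_zero, add_comm]; exact hu'
      rw [memK]
      change A *ᵥ ((1 + t • (S * B)) *ᵥ u) = 0
      rw [add_mulVec, one_mulVec, smul_mulVec, ← mulVec_mulVec, ← mulVec_smul, e, mulVec_neg,
        mulVec_add, mulVec_neg, hS, add_neg_cancel]
    have heq : Kt.map T = K := by
      apply Submodule.eq_of_le_of_finrank_le hle
      rw [← (Submodule.equivMapOfInjective T hTi Kt).finrank_eq]
      have h1 := hdim (A + t • B)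
      have h2 := hub t
      change finrank k K ≤ finrank k (LinearMap.ker (A + t • B).mulVecLin)
      omega
    rw [← heq] at hv
    obtain ⟨u, hu, huv⟩ := hv
    have : u = v := hTi huv
    subst this
    exact hu
  have first : ∀ x ∈ K, ∀ y ∈ K, ∀ t : k, t ≠ 0 → ∀ v,
      (∀ u, (1 + t • (S * B)) *ᵥ u = 0 → u = 0) →
      (1 + t • (S * B)) *ᵥ v = x → (B *ᵥ y) ⬝ᵥ v = 0 := by
    intro x hx y hy t ht v hinj hv
    have h1 := lift t ht v hinj (by rw [hv]; exact hx)
    have h2 : y ⬝ᵥ ((A + t • B) *ᵥ v) = 0 := by rw [h1, dotProduct_zero]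
    rw [add_mulVec, smul_mulVec, dotProduct_add, dotProduct_smul, symA, (memK y).1 hy,
      zero_dotProduct, zero_add, smul_eq_mul, symB] at h2
    exact (mul_eq_zero.mp h2).resolve_left ht
  have ord1 : ∀ x ∈ K, ∀ y ∈ K, (B *ᵥ y) ⬝ᵥ x = 0 := fun x hx y hy =>
    aux_limit (S * B) _ _ (first x hx y hy)
  have ord2 : ∀ x ∈ K, ∀ y ∈ K, (B *ᵥ y) ⬝ᵥ (S *ᵥ (B *ᵥ x)) = 0 := by
    intro x hx y hy
    have := aux_limit (S * B) ((B *ᵥ y) ᵥ* (S * B)) x (by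
      intro t ht v hinj hv
      have h1 := first x hx y hy t ht v hinj hv
      have h2 := ord1 x hx y hy
      rw [← hv, add_mulVec, one_mulVec, smul_mulVec, dotProduct_add, h1, zero_add,
        dotProduct_smul, smul_eq_mul] at h2
      rw [← dotProduct_mulVec]
      exact (mul_eq_zero.mp h2).resolve_left ht)
    rwa [← dotProduct_mulVec, ← mulVec_mulVec] at this
  -- the dot product form
  let D : LinearMap.BilinForm k (Fin N → k) := Matrix.toBilin' 1
  have hD : ∀ x y, D x y = x ⬝ᵥ y := fun x y => by
    simp [D, Matrix.toBilin'_apply']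
  have hDn : D.Nondegenerate := LinearMap.BilinForm.nondegenerate_toBilin'_of_det_ne_zero' 1 (by simp)
  have hperp : LinearMap.range A.mulVecLin = D.orthogonal K := by
    apply Submodule.eq_of_le_of_finrank_le
    · rintro _ ⟨u, rfl⟩
      rw [LinearMap.BilinForm.mem_orthogonal_iff]
      intro y hy
      change D y _ = 0
      rw [hD, mulVecLin_apply, symA, (memK y).1 hy, zero_dotProduct]
    · rw [LinearMap.BilinForm.finrank_orthogonal hDn, hKr]
      change _ ≤ A.rank
      simp [hrA]
  have hASB : ∀ x ∈ K, A *ᵥ (S *ᵥ (B *ᵥ x)) = B *ᵥ x := by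
    intro x hx
    have : B *ᵥ x ∈ LinearMap.range A.mulVecLin := by
      rw [hperp, LinearMap.BilinForm.mem_orthogonal_iff]
      intro y hy
      change D y _ = 0
      rw [hD, symB]
      exact ord1 x hx y hy
    obtain ⟨u, hu⟩ := this
    rw [mulVecLin_apply] at hu
    rw [← hu, hS]
  -- dimension count
  let Φ : (K × K) →ₗ[k] (Fin N → k) :=
    K.subtype.coprod ((S * B).mulVecLin ∘ₗ K.subtype)
  have hΦ : ∀ p : K × K, Φ p = (p.1 : Fin N → k) + S *ᵥ (B *ᵥ (p.2 : Fin N → k)) := by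
    intro p; simp [Φ]
  have hΦi : Function.Injective Φ := by
    rw [← LinearMap.ker_eq_bot, LinearMap.ker_eq_bot']
    rintro ⟨⟨x, hx⟩, ⟨y, hy⟩⟩ h
    rw [hΦ] at h
    simp only at h
    have h1 := congrArg (fun v => A *ᵥ v) h
    simp only [mulVec_add, mulVec_zero, hASB y hy, (memK x).1 hx, zero_add] at h1
    have hy0 := hinc y ((memK y).1 hy) h1
    subst hy0
    simp at h
    subst h
    rfl
  let BK := K.map B.mulVecLin
  have hBK : finrank k BK = r := by
    rw [← hKr]
    let g := B.mulVecLin ∘ₗ K.subtype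
    have hg : Function.Injective g := by
      rw [← LinearMap.ker_eq_bot, LinearMap.ker_eq_bot']
      rintro ⟨x, hx⟩ h
      have := hinc x ((memK x).1 hx) h
      subst this
      rfl
    have := LinearMap.finrank_range_of_inj hg
    rwa [LinearMap.range_comp, Submodule.range_subtype] at this
  have hle : LinearMap.range Φ ≤ D.orthogonal BK := by
    rintro _ ⟨⟨⟨x, hx⟩, ⟨y, hy⟩⟩, rfl⟩
    rw [LinearMap.BilinForm.mem_orthogonal_iff]
    rintro _ ⟨z, hz, rfl⟩
    change D _ _ = 0
    rw [hD, hΦ, mulVecLin_apply, dotProduct_add, ord1 x hx z hz, ord2 y hy z hz, add_zero]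
  have h3 := Submodule.finrank_mono hle
  rw [LinearMap.finrank_range_of_inj hΦi, LinearMap.BilinForm.finrank_orthogonal hDn, hBK,
    Module.finrank_prod, hKr, Module.finrank_fin_fun] at h3
  omega

/-- An incompressible pencil of quadrics in `Pⁿ` with generic corank `r₁`
(i.e. `n+1−r₁` is the maximal rank of the members `z₀A₁ + z₁A₂` of the pencil)
satisfies `3·r₁ ≤ n+1`. -/
theorem stmt_13 {k : Type*} [Field k] [IsAlgClosed k] (h2 : (2 : k) ≠ 0) (n : ℕ)
    (A₁ A₂ : Matrix (Fin (n + 1)) (Fin (n + 1)) k)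
    (hA₁ : A₁.IsSymm) (hA₂ : A₂.IsSymm)
    (hinc : ∀ x : Fin (n + 1) → k, A₁.mulVec x = 0 → A₂.mulVec x = 0 → x = 0)
    (r₁ : ℕ) (hr₁ : r₁ ≤ n + 1)
    (hmax : ∃ z : Fin 2 → k, z ≠ 0 ∧ (z 0 • A₁ + z 1 • A₂).rank = n + 1 - r₁)
    (hub : ∀ z : Fin 2 → k, (z 0 • A₁ + z 1 • A₂).rank ≤ n + 1 - r₁) :
    3 * r₁ ≤ n + 1 := by
  haveI : Infinite k := IsAlgClosed.instInfinite
  obtain ⟨z, hz, hzr⟩ := hmax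
  have hs : (z 0 • A₁ + z 1 • A₂).IsSymm := (hA₁.smul _).add (hA₂.smul _)
  by_cases h0 : z 0 = 0
  · have h1 : z 1 ≠ 0 := by
      intro h1
      apply hz
      ext i
      fin_cases i
      · exact h0
      · exact h1
    refine aux_core _ A₁ hs hA₁ ?_ r₁ hr₁ hzr ?_
    · intro x hx hx1
      rw [Matrix.add_mulVec, Matrix.smul_mulVec, Matrix.smul_mulVec, hx1, smul_zero,
        zero_add] at hx
      exact hinc x hx1 ((smul_eq_zero.mp hx).resolve_left h1)
    · intro t
      have := hub ![z 0 + t, z 1]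
      simp only [Matrix.cons_val_zero, Matrix.cons_val_one] at this
      convert! this using 2
      rw [add_smul]; abel
  · refine aux_core _ A₂ hs hA₂ ?_ r₁ hr₁ hzr ?_
    · intro x hx hx2
      rw [Matrix.add_mulVec, Matrix.smul_mulVec, Matrix.smul_mulVec, hx2, smul_zero,
        add_zero] at hx
      exact hinc x ((smul_eq_zero.mp hx).resolve_left h0) hx2
    · intro t
      have := hub ![z 0, z 1 + t]
      simp only [Matrix.cons_val_zero, Matrix.cons_val_one] at this
      convert! this using 2
      rw [add_smul]; abel
end
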